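/- arXiv:1809.06829 — 2 statements merged into one kernel-verified Lean document; each statement's English description precedes it below -/
import Mathlib

section
/- Let f : X → Y be a Lipschitz map between metric spaces with Lipschitz constant Lip f, let A ⊂ X, and let 0 ≤ m ≤ n. Then ∫*_Y ℋ^{n−m}(f⁻¹(y) ∩ A) dℋ^m(y) ≤ (Lip f)^m · (ω_{n−m} ω_m / ω_n) · ℋ^n(A), where ∫* denotes the upper integral. -/
open MeasureTheory Metric Set Filter
open scoped ENNReal NNReal Topology

noncomputable section

abbrev EucSp (k : ℕ) := EuclideanSpace ℝ (Fin k)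

/-- The volume of the unit ball in `ℝ^n`. -/
def unitBallVol (n : ℕ) : ℝ≥0∞ := volume (Metric.ball (0 : EucSp n) 1)

/-- The `n`-dimensional Hausdorff content. -/
def hContent {X : Type*} [PseudoEMetricSpace X] (n : ℕ) (E : Set X) : ℝ≥0∞ :=
  ⨅ (A : ℕ → Set X) (_ : E ⊆ ⋃ i, A i),
    unitBallVol n / 2 ^ n * ∑' i, EMetric.diam (A i) ^ n

/-- Upper n-density. -/
def upperDensity {k : ℕ} {X : Type*} [PseudoEMetricSpace X] (n : ℕ)
    (f : EucSp k → X) (A : Set (EucSp k)) (x : EucSp k) : ℝ≥0∞ :=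
  Filter.limsup
    (fun r : ℝ => hContent n (f '' (Metric.ball x r ∩ A)) /
      (unitBallVol n * ENNReal.ofReal r ^ n)) (𝓝[>] (0:ℝ))

def lowerDensity {k : ℕ} {X : Type*} [PseudoEMetricSpace X] (n : ℕ)
    (f : EucSp k → X) (A : Set (EucSp k)) (x : EucSp k) : ℝ≥0∞ :=
  Filter.liminf
    (fun r : ℝ => hContent n (f '' (Metric.ball x r ∩ A)) /
      (unitBallVol n * ENNReal.ofReal r ^ n)) (𝓝[>] (0:ℝ))

def IsDensityPoint {k : ℕ} (E : Set (EucSp k)) (x : EucSp k) : Prop :=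
  Filter.Tendsto (fun r : ℝ => volume (E ∩ Metric.ball x r) / volume (Metric.ball x r))
    (𝓝[>] (0:ℝ)) (𝓝 1)

def HasApproxDerivWithinAt {k : ℕ} (A : Set (EucSp k)) (f : EucSp k → ℝ)
    (L : EucSp k →ₗ[ℝ] ℝ) (x : EucSp k) : Prop :=
  ∃ Ax : Set (EucSp k), Ax ⊆ A ∧ MeasurableSet Ax ∧ IsDensityPoint Ax x ∧
    Filter.Tendsto (fun y => |f y - f x - L (y - x)| / ‖y - x‖) (𝓝[Ax] x) (𝓝 0)

abbrev LpInfty := lp (fun _ : ℕ => ℝ) ∞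

def HasCompApproxDerivWithinAt {k : ℕ} (A : Set (EucSp k)) (f : EucSp k → LpInfty)
    (D : EucSp k →ₗ[ℝ] (ℕ → ℝ)) (x : EucSp k) : Prop :=
  ∀ i : ℕ, HasApproxDerivWithinAt A (fun y => f y i) ((LinearMap.proj i).comp D) x

def IsBiLipC1DiffeoOn {k : ℕ} (G Ginv : EucSp k → EucSp k) (U : Set (EucSp k)) : Prop :=
  IsOpen U ∧ IsOpen (G '' U) ∧ (∀ x ∈ U, Ginv (G x) = x) ∧ (∀ y ∈ G '' U, G (Ginv y) = y) ∧
    ContDiffOn ℝ 1 G U ∧ ContDiffOn ℝ 1 Ginv (G '' U) ∧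
    ∃ Λ : ℝ≥0, LipschitzOnWith Λ G U ∧ LipschitzOnWith Λ Ginv (G '' U)

def IsFinCoordPerm (Ψ : LpInfty → LpInfty) : Prop :=
  ∃ σ : Equiv.Perm ℕ, {i | σ i ≠ i}.Finite ∧ ∀ (x : LpInfty) (i : ℕ), Ψ x i = x (σ i)

def openCube {k : ℕ} (c : EucSp k) (d : ℝ) : Set (EucSp k) := {x | ∀ i, |x i - c i| < d / 2}

def closedCube {k : ℕ} (c : EucSp k) (d : ℝ) : Set (EucSp k) := {x | ∀ i, |x i - c i| ≤ d / 2}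

def hnmContent {N : ℕ} {X : Type*} [PseudoEMetricSpace X] (n m : ℕ)
    (f : EucSp N → X) (Q : Set (EucSp N)) : ℝ≥0∞ :=
  ⨅ (c : ℕ → EucSp N) (d : ℕ → ℝ) (_ : ∀ j, 0 ≤ d j) (_ : ∀ j, openCube (c j) (d j) ⊆ Q)
    (_ : Pairwise (Function.onFun Disjoint fun j => openCube (c j) (d j)))
    (_ : volume (Q \ ⋃ j, openCube (c j) (d j)) = 0),
    ∑' j, hContent n (f '' openCube (c j) (d j)) * ENNReal.ofReal (d j) ^ m

def matrixRow {n k : ℕ} (D : Matrix (Fin n) (Fin k) ℝ) (i : Fin n) : EucSp k →ₗ[ℝ] ℝ :=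
  (EuclideanSpace.proj i).toLinearMap.comp (Matrix.toEuclideanLin D)

def jacDet {n k : ℕ} (D : Matrix (Fin n) (Fin k) ℝ) : ℝ := Real.sqrt ((D * D.transpose).det)

def upperLintegral {Y : Type*} [MeasurableSpace Y] (μ : Measure Y) (g : Y → ℝ≥0∞) : ℝ≥0∞ :=
  ⨅ (h : Y → ℝ≥0∞) (_ : Measurable h) (_ : ∀ y, g y ≤ h y), ∫⁻ y, h y ∂μ


/-- Hausdorff premeasure at scale `r`. -/
def hpre {Y : Type*} [EMetricSpace Y] (m : ℕ) (r : ℝ≥0∞) : OuterMeasure Y :=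
  OuterMeasure.mkMetric'.pre (fun s => Metric.ediam s ^ m) r

theorem hpre_le {Y : Type*} [EMetricSpace Y] (m : ℕ) (r : ℝ≥0∞) (s : Set Y)
    (h : Metric.ediam s ≤ r) : hpre m r s ≤ Metric.ediam s ^ m :=
  OuterMeasure.mkMetric'.pre_le h

theorem hpre_tendsto {Y : Type*} [EMetricSpace Y] [MeasurableSpace Y] [BorelSpace Y]
    (m : ℕ) (s : Set Y) :
    Tendsto (fun r => hpre m r s) (𝓝[>] 0) (𝓝 (μH[(m : ℝ)] s)) := by
  have h := OuterMeasure.mkMetric'.tendsto_pre (fun s : Set Y => Metric.ediam s ^ m) s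
  have e : (μH[(m : ℝ)] : Measure Y) s
      = OuterMeasure.mkMetric' (fun s : Set Y => Metric.ediam s ^ m) s := by
    rw [Measure.hausdorffMeasure, ← OuterMeasure.coe_mkMetric]
    simp only [ENNReal.rpow_natCast]
    rfl
  rw [e]
  exact h

theorem hpre_le_measure {Y : Type*} [EMetricSpace Y] [MeasurableSpace Y] [BorelSpace Y]
    (m : ℕ) (r : ℝ≥0∞) (hr : 0 < r) (s : Set Y) : hpre m r s ≤ μH[(m : ℝ)] s := by
  refine ge_of_tendsto (hpre_tendsto m s) ?_
  filter_upwards [Ioo_mem_nhdsGT hr] with r' hr'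
  exact OuterMeasure.mkMetric'.mono_pre _ hr'.2.le s

theorem density_lemma {Y : Type*} [EMetricSpace Y] [MeasurableSpace Y] [BorelSpace Y]
    (m : ℕ) (B : Set Y) (hB : MeasurableSet B) (hfin : μH[(m : ℝ)] B ≠ ∞)
    (ε : ℝ≥0) (hε : 0 < ε) (η : ℝ≥0) (hη : 0 < η) :
    ∃ δ : ℝ≥0∞, 0 < δ ∧ ∃ B' ⊆ B, MeasurableSet B' ∧ μH[(m : ℝ)] (B \ B') ≤ η ∧
      ∀ E : Set Y, MeasurableSet E → Metric.ediam E ≤ δ →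
        μH[(m : ℝ)] (B' ∩ E) ≤ (1 + ε) * Metric.ediam E ^ m := by
  set μ : Measure Y := μH[(m : ℝ)] with hμ
  set s : ℝ≥0 := η * ε / (1 + ε) with hs
  have hs0 : 0 < s := by positivity
  obtain ⟨δ, hδ0, hδ⟩ : ∃ δ : ℝ≥0∞, 0 < δ ∧ μ B ≤ hpre m δ B + s := by
    have h1 : Tendsto (fun r => hpre m r B + (s : ℝ≥0∞)) (𝓝[>] 0) (𝓝 (μ B + s)) :=
      (hpre_tendsto m B).add tendsto_const_nhds
    have h2 : μ B < μ B + s := ENNReal.lt_add_right hfin (by simpa using hs0.ne')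
    have h3 := (h1.eventually (lt_mem_nhds h2)).and self_mem_nhdsWithin
    obtain ⟨δ, h4, h5⟩ := h3.exists
    exact ⟨δ, h5, h4.le⟩
  let P : Set Y → Prop := fun Q => MeasurableSet Q ∧ Q ⊆ B ∧ 0 < μ Q ∧ (1 + ε) * hpre m δ Q ≤ μ Q
  obtain ⟨F, hF⟩ := zorn_subset {F : Set (Set Y) | (∀ Q ∈ F, P Q) ∧ F.PairwiseDisjoint id} (by
    intro c hc hch
    refine ⟨⋃₀ c, ⟨?_, ?_⟩, fun s hs => subset_sUnion_of_mem hs⟩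
    · rintro Q ⟨F, hF, hQ⟩
      exact (hc hF).1 Q hQ
    · exact (pairwiseDisjoint_sUnion hch.directedOn).2 fun F hF => (hc hF).2)
  obtain ⟨⟨hFP, hFd⟩, hmax⟩ := hF
  have hFc : F.Countable := by
    have := Measure.countable_meas_pos_of_disjoint_of_meas_iUnion_ne_top
      (μ := μ) (As := fun Q : F => (Q : Set Y)) (fun Q => (hFP Q Q.2).1)
      (fun Q Q' h => hFd Q.2 Q'.2 (fun h' => h (Subtype.ext h')))
      (ne_top_of_le_ne_top hfin (measure_mono (iUnion_subset fun Q => (hFP Q Q.2).2.1)))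
    have h2 : {i : F | 0 < μ (i : Set Y)} = univ := by
      ext Q; simpa using (hFP Q Q.2).2.2.1
    rw [h2, countable_univ_iff] at this
    exact this
  set R := ⋃₀ F with hR
  have hRm : MeasurableSet R := MeasurableSet.sUnion hFc fun Q hQ => (hFP Q hQ).1
  have hRB : R ⊆ B := sUnion_subset fun Q hQ => (hFP Q hQ).2.1
  have hRP : (1 + ε) * hpre m δ R ≤ μ R := by
    have : Countable F := hFc
    rw [hR, measure_sUnion hFc hFd (fun Q hQ => (hFP Q hQ).1), sUnion_eq_iUnion]
    calc (1 + (ε : ℝ≥0∞)) * hpre m δ (⋃ i : F, (i : Set Y))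
        ≤ (1 + ε) * ∑' i : F, hpre m δ (i : Set Y) := by
          gcongr; exact measure_iUnion_le _
      _ = ∑' i : F, (1 + ε) * hpre m δ (i : Set Y) := ENNReal.tsum_mul_left.symm
      _ ≤ _ := ENNReal.tsum_le_tsum fun Q => (hFP Q Q.2).2.2.2
  refine ⟨δ, hδ0, B \ R, sdiff_subset, hB.diff hRm, ?_, ?_⟩
  · rw [sdiff_sdiff_cancel_left hRB]
    have h1 : μ R + μ (B \ R) = μ B := by
      rw [← measure_union disjoint_sdiff_right (hB.diff hRm), union_sdiff_cancel hRB]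
    have hRf : μ R ≠ ∞ := ne_top_of_le_ne_top hfin (measure_mono hRB)
    have hBf : μ (B \ R) ≠ ∞ := ne_top_of_le_ne_top hfin (measure_mono sdiff_subset)
    have h2 : hpre m δ B ≤ hpre m δ R + μ (B \ R) := by
      calc hpre m δ B = hpre m δ (R ∪ (B \ R)) := by rw [union_sdiff_cancel hRB]
        _ ≤ hpre m δ R + hpre m δ (B \ R) := measure_union_le _ _
        _ ≤ _ := by gcongr; exact hpre_le_measure m δ hδ0 _
    have h3 : μ R + μ (B \ R) ≤ (hpre m δ R + s) + μ (B \ R) := by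
      rw [h1]; refine hδ.trans ((add_le_add_left h2 _).trans (le_of_eq ?_)); ring
    have h4 : μ R ≤ hpre m δ R + s := ENNReal.le_of_add_le_add_right hBf h3
    have hpf : hpre m δ R ≠ ∞ := ne_top_of_le_ne_top hRf (hpre_le_measure m δ hδ0 _)
    generalize hx : μ R = x at *
    generalize hpre m δ R = p at *
    lift x to ℝ≥0 using hRf
    lift p to ℝ≥0 using hpf
    norm_cast at h4 hRP ⊢
    have h5 : (s : ℝ) * (1 + ε) = η * ε := by
      rw [hs]; push_cast; field_simp
    have h4' : (x : ℝ) ≤ p + s := by exact_mod_cast h4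
    have h6 : (1 + (ε : ℝ)) * p ≤ x := by exact_mod_cast hRP
    have h7 : (0 : ℝ) < ε := hε
    have : (x : ℝ) ≤ η := by
      have : (x : ℝ) * ε ≤ η * ε := by nlinarith
      exact le_of_mul_le_mul_right this h7
    exact_mod_cast this
  · intro E hE hEd
    by_contra! hlt
    have hQ : P ((B \ R) ∩ E) := by
      refine ⟨(hB.diff hRm).inter hE, inter_subset_left.trans sdiff_subset,
        lt_of_le_of_lt zero_le hlt, le_trans ?_ hlt.le⟩
      gcongr
      exact (measure_mono inter_subset_right).trans (hpre_le m δ E hEd)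
    have hdis : ∀ Q ∈ F, Disjoint ((B \ R) ∩ E) Q := by
      intro Q hQ
      refine Set.disjoint_left.2 fun y hy hyQ => hy.1.2 (mem_sUnion_of_mem hyQ hQ)
    have hins : insert ((B \ R) ∩ E) F ⊆ F := hmax (y := insert ((B \ R) ∩ E) F)
      ⟨by
        rintro Q (rfl | hQ')
        · exact hQ
        · exact hFP Q hQ', hFd.insert fun Q hQ _ => hdis Q hQ⟩ (subset_insert _ _)
    have := hdis _ (hins (mem_insert _ _))
    rw [disjoint_self] at this
    have h0 := hQ.2.2.1
    rw [this] at h0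
    simp at h0

theorem exists_sel (t : ℝ) (V : Set ℝ) (a : ℝ≥0∞) : ∃ W : Set ℝ,
    MeasurableSet V → V ⊆ Ico 0 t → (W ⊆ V ∧ MeasurableSet W ∧ volume W ≤ a ∧
      (volume W = a ∨ W = V)) := by
  by_cases hV : MeasurableSet V
  swap
  · exact ⟨∅, fun h => absurd h hV⟩
  by_cases hVt : V ⊆ Ico 0 t
  swap
  · exact ⟨∅, fun _ h => absurd h hVt⟩
  rcases le_or_gt (volume V) a with hle | hlt
  · exact ⟨V, fun _ _ => ⟨Subset.rfl, hV, hle, Or.inr rfl⟩⟩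
  have hfin : ∀ x : ℝ, volume (V ∩ Iio x) ≠ ∞ := fun x =>
    ne_top_of_le_ne_top (by simp : volume (Ico 0 t) ≠ ∞)
      (measure_mono (inter_subset_left.trans hVt))
  have hlip : LipschitzWith 1 (fun x : ℝ => (volume (V ∩ Iio x)).toReal) := by
    refine LipschitzWith.of_le_add fun x y => ?_
    have h1 : volume (V ∩ Iio x) ≤ volume (V ∩ Iio y) + ENNReal.ofReal (dist x y) := by
      calc volume (V ∩ Iio x) ≤ volume ((V ∩ Iio y) ∪ Ico y x) := by
            refine measure_mono fun z hz => ?_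
            rcases lt_or_ge z y with h | h
            · exact Or.inl ⟨hz.1, h⟩
            · exact Or.inr ⟨h, hz.2⟩
        _ ≤ volume (V ∩ Iio y) + volume (Ico y x) := measure_union_le _ _
        _ ≤ _ := by
            gcongr
            rw [Real.volume_Ico]
            exact ENNReal.ofReal_le_ofReal (le_abs_self _)
    have h2 := ENNReal.toReal_mono (by simp [hfin]) h1
    rwa [ENNReal.toReal_add (hfin _) (by simp), ENNReal.toReal_ofReal dist_nonneg] at h2
  have hafin : a ≠ ∞ := ne_top_of_lt hlt
  have hVe : V ∩ Iio t = V := inter_eq_left.2 fun z hz => (hVt hz).2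
  have hV0 : V ∩ Iio 0 = ∅ := by
    ext z; simp only [mem_inter_iff, mem_Iio, mem_empty_iff_false, iff_false, not_and, not_lt]
    exact fun hz => (hVt hz).1
  have hVfin : volume V ≠ ∞ := hVe ▸ hfin t
  have ht : 0 ≤ t := by
    by_contra! h
    have : V = ∅ := by
      rw [Ico_eq_empty (by linarith)] at hVt; exact subset_empty_iff.1 hVt
    simp [this] at hlt
  obtain ⟨x, -, hx⟩ := intermediate_value_Icc ht hlip.continuous.continuousOn
    (show a.toReal ∈ Icc _ _ by
      simp only [hV0, hVe]
      exact ⟨by simp, ENNReal.toReal_mono hVfin hlt.le⟩)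
  have hx' : volume (V ∩ Iio x) = a := by
    exact (ENNReal.toReal_eq_toReal_iff' (hfin x) hafin).1 hx
  exact ⟨V ∩ Iio x, fun _ _ => ⟨inter_subset_left, hV.inter measurableSet_Iio, hx'.le, Or.inl hx'⟩⟩

theorem time_lemma (t : ℝ) (a : ℕ → ℝ≥0∞) (κ : ℕ → ℕ) (M : ℕ → ℕ → Prop) :
    ∃ (r : ℕ → ℕ → Prop) (U : ℕ → Set ℝ), (∀ i j, r i j → κ i ≤ κ j) ∧
      (∀ i j, i ≠ j → r i j ∨ r j i) ∧
      (∀ i, MeasurableSet (U i) ∧ volume (U i) ≤ a i ∧ U i ⊆ Ico 0 t ∧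
        (∀ j, r j i → M j i → Disjoint (U j) (U i)) ∧
        (volume (U i) = a i ∨ ∀ s ∈ Ico 0 t, s ∉ U i → ∃ j, r j i ∧ M j i ∧ s ∈ U j)) := by
  choose sel hsel using exists_sel t
  let r : ℕ → ℕ → Prop := fun j i => toLex (κ j, j) < toLex (κ i, i)
  have wf : WellFounded r := InvImage.wf (fun i => toLex (κ i, i)) wellFounded_lt
  let F : (i : ℕ) → ((j : ℕ) → r j i → Set ℝ) → Set ℝ := fun i ih =>
    sel (Ico 0 t \ ⋃ j, ⋃ (h : r j i), ⋃ (_ : M j i), ih j h) (a i)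
  let U : ℕ → Set ℝ := wf.fix F
  have hU : ∀ i, U i = sel (Ico 0 t \ ⋃ j, ⋃ (_ : r j i), ⋃ (_ : M j i), U j) (a i) :=
    fun i => wf.fix_eq F i
  have hUm : ∀ i, MeasurableSet (U i) := by
    intro i
    induction i using wf.induction with
    | _ i ih =>
      rw [hU i]
      refine (hsel _ (a i) ?_ sdiff_subset).2.1
      exact measurableSet_Ico.diff (MeasurableSet.iUnion fun j => MeasurableSet.iUnion fun h =>
        MeasurableSet.iUnion fun _ => ih j h)
  refine ⟨r, U, ?_, ?_, ?_⟩
  · intro i j h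
    rcases Prod.Lex.toLex_lt_toLex.1 h with h | h
    · exact h.le
    · exact h.1.le
  · intro i j hij
    refine lt_or_gt_of_ne fun h => hij ?_
    have := congrArg (fun x => (ofLex x).2) h
    exact this
  · intro i
    obtain ⟨h1, h2, h3, h4⟩ := hsel (Ico 0 t \ ⋃ j, ⋃ (_ : r j i), ⋃ (_ : M j i), U j) (a i)
      (measurableSet_Ico.diff (MeasurableSet.iUnion fun j => MeasurableSet.iUnion fun h =>
        MeasurableSet.iUnion fun _ => hUm j)) sdiff_subset
    rw [← hU i] at h1 h2 h3 h4
    refine ⟨h2, h3, h1.trans sdiff_subset, ?_, ?_⟩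
    · intro j hj hM
      refine Set.disjoint_left.2 fun s hs hs' => (h1 hs').2 ?_
      simp only [mem_iUnion]
      exact ⟨j, hj, hM, hs⟩
    · rcases h4 with h4 | h4
      · exact Or.inl h4
      · right
        intro s hs hsU
        rw [h4] at hsU
        by_contra hcon
        refine hsU ⟨hs, fun h => hcon ?_⟩
        simp only [mem_iUnion] at h
        obtain ⟨j, a, b, c⟩ := h
        exact ⟨j, a, b, c⟩

theorem weighted_cover {Y : Type*} [EMetricSpace Y] (m : ℕ) (E : ℕ → Set Y)
    (a : ℕ → ℝ≥0∞) (ρ : ℕ → ℝ) (hρ0 : ∀ i, 0 < ρ i) (hρ1 : ∀ i, ρ i ≤ 1) (δ : ℝ≥0∞)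
    (hδ : ∀ i, 5 * ENNReal.ofReal (ρ i) ≤ δ)
    (hE : ∀ i, Metric.ediam (E i) ≤ ENNReal.ofReal (ρ i)) (T : ℝ≥0∞) (hT : T ≠ ∞)
    (hsum : ∑' i, a i * ENNReal.ofReal (ρ i) ^ m ≤ T) (t : ℝ) (ht : 0 < t) (B : Set Y)
    (hB : ∀ y ∈ B, ENNReal.ofReal t < ∑' i, (E i).indicator (fun _ => a i) y) :
    hpre m δ B ≤ 5 ^ m * ((T + 1) / ENNReal.ofReal t) := by
  have hκ : ∀ i, ∃ n : ℕ, (1 / 2 : ℝ) ^ (n + 1) < ρ i ∧ ρ i ≤ (1 / 2 : ℝ) ^ n := fun i =>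
    exists_nat_pow_near_of_lt_one (hρ0 i) (hρ1 i) (by norm_num) (by norm_num)
  choose κ hκ1 hκ2 using hκ
  have hκ : ∀ i j, κ i ≤ κ j → ρ j ≤ 2 * ρ i := by
    intro i j h
    have h1 : (1 / 2 : ℝ) ^ (κ j) ≤ (1 / 2 : ℝ) ^ (κ i) :=
      pow_le_pow_of_le_one (by norm_num) (by norm_num) h
    have h2 := hκ1 i
    rw [pow_succ] at h2
    linarith [hκ2 j]
  obtain ⟨r, U, hr, hrt, hU⟩ := time_lemma t a κ (fun i j => (E i ∩ E j).Nonempty)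
  -- at every time the enlargements cover
  have hcov : ∀ s ∈ Ico 0 t, ∀ y ∈ B, ∃ i j, y ∈ E i ∧ s ∈ U j ∧ (E j ∩ E i).Nonempty ∧
      κ j ≤ κ i := by
    intro s hs y hy
    by_contra! hcon
    have hsU : ∀ i, y ∈ E i → s ∉ U i := fun i hi hsi =>
      (hcon i i hi hsi ⟨y, hi, hi⟩).false
    have hvol : ∀ i, y ∈ E i → volume (U i) = a i := by
      intro i hi
      rcases (hU i).2.2.2.2 with h | h
      · exact h
      · obtain ⟨j, h1, h2, h3⟩ := h s hs (hsU i hi)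
        exact absurd (hr j i h1) (not_le.2 (hcon i j hi h3 h2))
    let W : ℕ → Set ℝ := fun i => {x | y ∈ E i ∧ x ∈ U i}
    have hW : ∀ i, volume (W i) = (E i).indicator (fun _ => a i) y := by
      intro i
      by_cases hi : y ∈ E i
      · simp [W, hi, hvol i hi]
      · simp [W, hi]
    have hWm : ∀ i, MeasurableSet (W i) := by
      intro i
      by_cases hi : y ∈ E i
      · simpa [W, hi] using (hU i).1
      · simp [W, hi]
    have hWd : Pairwise (Function.onFun Disjoint W) := by
      intro i j hij
      refine Set.disjoint_left.2 fun x hx hx' => ?_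
      rcases hrt i j hij with h | h
      · exact Set.disjoint_left.1 ((hU j).2.2.2.1 i h ⟨y, hx.1, hx'.1⟩) hx.2 hx'.2
      · exact Set.disjoint_left.1 ((hU i).2.2.2.1 j h ⟨y, hx'.1, hx.1⟩) hx'.2 hx.2
    have h1 := hB y hy
    simp_rw [← hW] at h1
    rw [← measure_iUnion hWd hWm] at h1
    have h2 : volume (⋃ i, W i) ≤ volume (Ico 0 t) :=
      measure_mono (iUnion_subset fun i x hx => (hU i).2.2.1 hx.2)
    rw [Real.volume_Ico, sub_zero] at h2
    exact absurd h1 (not_lt.2 h2)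
  -- choose a good time
  obtain ⟨s, hs, hsT⟩ : ∃ s ∈ Ico 0 t,
      ∑' i, (U i).indicator (fun _ => ENNReal.ofReal (ρ i) ^ m) s ≤
        (T + 1) / ENNReal.ofReal t := by
    by_contra! hcon
    have ht0 : ENNReal.ofReal t ≠ 0 := by simpa using ht
    have h1 : ∫⁻ s in Ico 0 t, (T + 1) / ENNReal.ofReal t ≤
        ∫⁻ s in Ico 0 t, ∑' i, (U i).indicator (fun _ => ENNReal.ofReal (ρ i) ^ m) s :=
      setLIntegral_mono' measurableSet_Ico fun s hs => (hcon s hs).le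
    rw [setLIntegral_const, Real.volume_Ico, sub_zero,
      ENNReal.div_mul_cancel ht0 ENNReal.ofReal_ne_top,
      lintegral_tsum (fun i => (measurable_const.indicator (hU i).1).aemeasurable)] at h1
    have h2 : ∀ i, ∫⁻ s in Ico 0 t, (U i).indicator (fun _ => ENNReal.ofReal (ρ i) ^ m) s ≤
        a i * ENNReal.ofReal (ρ i) ^ m := by
      intro i
      refine (setLIntegral_le_lintegral _ _).trans ?_
      rw [lintegral_indicator_const (hU i).1, mul_comm]
      gcongr
      exact (hU i).2.1
    have h3 := h1.trans ((ENNReal.tsum_le_tsum h2).trans hsum)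
    exact absurd h3 (not_le.2 (ENNReal.lt_add_right hT one_ne_zero))
  let G : ℕ → Set Y := fun j => {y | s ∈ U j ∧ ∃ i, y ∈ E i ∧ (E j ∩ E i).Nonempty ∧ κ j ≤ κ i}
  have hGd : ∀ j, Metric.ediam (G j) ≤ 5 * ENNReal.ofReal (ρ j) := by
    intro j
    refine Metric.ediam_le ?_
    rintro y ⟨-, i, hyi, ⟨z, hzj, hzi⟩, hi⟩ y' ⟨-, i', hyi', ⟨z', hzj', hzi'⟩, hi'⟩
    have e1 : edist y z ≤ 2 * ENNReal.ofReal (ρ j) := by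
      refine (Metric.edist_le_ediam_of_mem hyi hzi).trans ((hE i).trans ?_)
      rw [← ENNReal.ofReal_ofNat 2, ← ENNReal.ofReal_mul (by norm_num)]
      exact ENNReal.ofReal_le_ofReal (hκ j i hi)
    have e2 : edist z' y' ≤ 2 * ENNReal.ofReal (ρ j) := by
      refine (Metric.edist_le_ediam_of_mem hzi' hyi').trans ((hE i').trans ?_)
      rw [← ENNReal.ofReal_ofNat 2, ← ENNReal.ofReal_mul (by norm_num)]
      exact ENNReal.ofReal_le_ofReal (hκ j i' hi')
    have e3 : edist z z' ≤ ENNReal.ofReal (ρ j) :=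
      (Metric.edist_le_ediam_of_mem hzj hzj').trans (hE j)
    calc edist y y' ≤ edist y z + edist z z' + edist z' y' := edist_triangle4 _ _ _ _
      _ ≤ 2 * ENNReal.ofReal (ρ j) + ENNReal.ofReal (ρ j) + 2 * ENNReal.ofReal (ρ j) := by
        gcongr
      _ = _ := by ring
  have hBG : B ⊆ ⋃ j, G j := by
    intro y hy
    obtain ⟨i, j, h1, h2, h3, h4⟩ := hcov s hs y hy
    exact mem_iUnion.2 ⟨j, h2, i, h1, h3, h4⟩
  have hGp : ∀ j, hpre m δ (G j) ≤
      5 ^ m * (U j).indicator (fun _ => ENNReal.ofReal (ρ j) ^ m) s := by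
    intro j
    by_cases hj : s ∈ U j
    · rw [indicator_of_mem hj, ← mul_pow]
      refine (hpre_le m δ _ ((hGd j).trans (hδ j))).trans ?_
      gcongr
      exact hGd j
    · have : G j = ∅ := by
        ext y; simp [G, hj]
      simp [this]
  calc hpre m δ B ≤ hpre m δ (⋃ j, G j) := measure_mono hBG
    _ ≤ ∑' j, hpre m δ (G j) := measure_iUnion_le _
    _ ≤ ∑' j, 5 ^ m * (U j).indicator (fun _ => ENNReal.ofReal (ρ j) ^ m) s :=
      ENNReal.tsum_le_tsum hGp
    _ = 5 ^ m * ∑' j, (U j).indicator (fun _ => ENNReal.ofReal (ρ j) ^ m) s :=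
      ENNReal.tsum_mul_left
    _ ≤ _ := by gcongr

theorem integral_finite {Y : Type*} [EMetricSpace Y] [MeasurableSpace Y] [BorelSpace Y]
    (m : ℕ) (E : ℕ → ℕ → Set Y) (hEm : ∀ k i, MeasurableSet (E k i))
    (a : ℕ → ℕ → ℝ≥0∞) (ρ : ℕ → ℕ → ℝ)
    (hρ1 : ∀ k i, ρ k i ≤ 1 / ((k : ℝ) + 1))
    (hE : ∀ k i, Metric.ediam (E k i) ≤ ENNReal.ofReal (ρ k i)) (T : ℝ≥0)
    (hsum : ∀ k, ∑' i, a k i * ENNReal.ofReal (ρ k i) ^ m ≤ T)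
    (B : Set Y) (hB : MeasurableSet B) (hBf : μH[(m : ℝ)] B ≠ ∞) :
    ∫⁻ y in B, liminf (fun k => ∑' i, (E k i).indicator (fun _ => a k i) y) atTop
      ∂(μH[(m : ℝ)] : Measure Y) ≤ T := by
  set μ : Measure Y := μH[(m : ℝ)] with hμ
  set g : ℕ → Y → ℝ≥0∞ := fun k y => ∑' i, (E k i).indicator (fun _ => a k i) y with hg
  have hgm : ∀ k, Measurable (g k) := fun k =>
    Measurable.tsum fun i => measurable_const.indicator (hEm k i)
  set u : Y → ℝ≥0∞ := fun y => liminf (fun k => g k y) atTop with hu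
  have hum : Measurable u := Measurable.liminf hgm
  change ∫⁻ y in B, u y ∂μ ≤ T
  have key : ∀ N : ℕ, ∫⁻ y in B, min (u y) N ∂μ ≤ T := by
    intro N
    refine ENNReal.le_of_forall_pos_le_add fun ε' hε' _ => ?_
    set ε : ℝ≥0 := ε' / (T + 1) with hεd
    have hε : 0 < ε := by positivity
    obtain ⟨δ, hδ0, B', hB'B, hB'm, hB'η, hB'E⟩ := density_lemma m B hB hBf ε hε (ε / (N + 1))
      (by positivity)
    have hd : ∀ᶠ k : ℕ in atTop, ∀ i, Metric.ediam (E k i) ≤ δ := by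
      have h1 : Tendsto (fun k : ℕ => ENNReal.ofReal (1 / ((k : ℝ) + 1))) atTop (𝓝 0) := by
        rw [← ENNReal.ofReal_zero]
        exact (ENNReal.continuous_ofReal.tendsto _).comp tendsto_one_div_add_atTop_nhds_zero_nat
      filter_upwards [h1.eventually (gt_mem_nhds hδ0)] with k hk i
      exact (hE k i).trans ((ENNReal.ofReal_le_ofReal (hρ1 k i)).trans hk.le)
    have h1 : ∫⁻ y in B', u y ∂μ ≤ (1 + ε) * T := by
      refine (lintegral_liminf_le hgm).trans ?_
      refine liminf_le_of_frequently_le' (Eventually.frequently ?_)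
      filter_upwards [hd] with k hk
      rw [lintegral_tsum (fun i => (measurable_const.indicator (hEm k i)).aemeasurable)]
      calc ∑' i, ∫⁻ y in B', (E k i).indicator (fun _ => a k i) y ∂μ
          ≤ ∑' i, (1 + ε) * (a k i * ENNReal.ofReal (ρ k i) ^ m) := by
            refine ENNReal.tsum_le_tsum fun i => ?_
            rw [lintegral_indicator_const (hEm k i), Measure.restrict_apply (hEm k i), inter_comm]
            calc a k i * μ (B' ∩ E k i) ≤ a k i * ((1 + ε) * ENNReal.ofReal (ρ k i) ^ m) := by
                  gcongr
                  refine (hB'E _ (hEm k i) (hk i)).trans ?_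
                  gcongr
                  exact hE k i
              _ = _ := by ring
        _ = (1 + ε) * ∑' i, (a k i * ENNReal.ofReal (ρ k i) ^ m) := ENNReal.tsum_mul_left
        _ ≤ _ := by gcongr; exact hsum k
    have h2 : ∫⁻ y in B \ B', min (u y) N ∂μ ≤ ε := by
      calc ∫⁻ y in B \ B', min (u y) N ∂μ ≤ ∫⁻ y in B \ B', (N : ℝ≥0∞) ∂μ :=
            lintegral_mono fun y => min_le_right _ _
        _ = N * μ (B \ B') := setLIntegral_const _ _
        _ ≤ N * ((ε / (N + 1) : ℝ≥0) : ℝ≥0∞) := by gcongr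
        _ ≤ ε := by
          norm_cast
          rw [← NNReal.coe_le_coe]
          push_cast
          rw [mul_div_assoc', div_le_iff₀ (by positivity)]
          nlinarith [ε.2, (NNReal.coe_nonneg ε)]
    calc ∫⁻ y in B, min (u y) N ∂μ = ∫⁻ y in B' ∪ (B \ B'), min (u y) N ∂μ := by
          rw [union_sdiff_cancel hB'B]
      _ ≤ ∫⁻ y in B', min (u y) N ∂μ + ∫⁻ y in B \ B', min (u y) N ∂μ :=
          lintegral_union_le _ _ _
      _ ≤ (1 + ε) * T + ε := by
          gcongr
          exact (lintegral_mono fun y => min_le_left _ _).trans h1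
      _ = T + ε' := by
          norm_cast
          rw [← NNReal.coe_inj, hεd]
          push_cast
          field_simp
          ring
  have hsup : ∀ y, u y = ⨆ N : ℕ, min (u y) N := by
    intro y
    refine le_antisymm ?_ (iSup_le fun N => min_le_left _ _)
    rw [← inf_iSup_eq (u y) (fun N : ℕ => (N : ℝ≥0∞)), ENNReal.iSup_natCast]
    simp
  calc ∫⁻ y in B, u y ∂μ = ∫⁻ y in B, ⨆ N : ℕ, min (u y) N ∂μ := by
        simp_rw [← hsup]
    _ = ⨆ N : ℕ, ∫⁻ y in B, min (u y) N ∂μ := by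
        refine lintegral_iSup (fun N => hum.min measurable_const) ?_
        intro N N' h y
        exact min_le_min le_rfl (by exact_mod_cast h)
    _ ≤ T := iSup_le key

theorem integral_bound {Y : Type*} [EMetricSpace Y] [MeasurableSpace Y] [BorelSpace Y]
    (m : ℕ) (E : ℕ → ℕ → Set Y) (hEm : ∀ k i, MeasurableSet (E k i))
    (a : ℕ → ℕ → ℝ≥0∞) (ρ : ℕ → ℕ → ℝ) (hρ0 : ∀ k i, 0 < ρ k i)
    (hρ1 : ∀ k i, ρ k i ≤ 1 / ((k : ℝ) + 1))
    (hE : ∀ k i, Metric.ediam (E k i) ≤ ENNReal.ofReal (ρ k i)) (T : ℝ≥0)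
    (hsum : ∀ k, ∑' i, a k i * ENNReal.ofReal (ρ k i) ^ m ≤ T) :
    ∫⁻ y, liminf (fun k => ∑' i, (E k i).indicator (fun _ => a k i) y) atTop
      ∂(μH[(m : ℝ)] : Measure Y) ≤ T := by
  set μ : Measure Y := μH[(m : ℝ)] with hμ
  set g : ℕ → Y → ℝ≥0∞ := fun k y => ∑' i, (E k i).indicator (fun _ => a k i) y with hg
  have hgm : ∀ k, Measurable (g k) := fun k =>
    Measurable.tsum fun i => measurable_const.indicator (hEm k i)
  let B : ℕ → Set Y := fun N => ⋂ k, ⋂ (_ : N ≤ k), {y | ENNReal.ofReal (1 / ((N : ℝ) + 1)) < g k y}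
  have hBm : ∀ N, MeasurableSet (B N) := fun N =>
    MeasurableSet.iInter fun k => MeasurableSet.iInter fun _ =>
      measurableSet_lt measurable_const (hgm k)
  have hBmono : Monotone B := by
    intro N N' h y hy
    simp only [B, mem_iInter, mem_ofPred_eq] at hy ⊢
    intro k hk
    refine lt_of_le_of_lt (ENNReal.ofReal_le_ofReal ?_) (hy k (h.trans hk))
    exact Nat.one_div_le_one_div h
  have hone : ∀ k : ℕ, 1 / ((k : ℝ) + 1) ≤ 1 := fun k => by
    rw [div_le_one (by positivity)]; linarith [(Nat.cast_nonneg k : (0 : ℝ) ≤ k)]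
  have hBfin : ∀ N, μ (B N) ≠ ∞ := by
    intro N
    have hlim : Tendsto (fun k : ℕ => 5 * ENNReal.ofReal (1 / ((k : ℝ) + 1))) atTop (𝓝[>] 0) := by
      refine tendsto_nhdsWithin_iff.2 ⟨?_, Eventually.of_forall fun k => ?_⟩
      · have h1 : Tendsto (fun k : ℕ => ENNReal.ofReal (1 / ((k : ℝ) + 1))) atTop (𝓝 0) := by
          rw [← ENNReal.ofReal_zero]
          exact (ENNReal.continuous_ofReal.tendsto _).comp tendsto_one_div_add_atTop_nhds_zero_nat
        simpa using ENNReal.Tendsto.const_mul (a := 5) h1 (Or.inr (by simp))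
      · have : 0 < ENNReal.ofReal (1 / ((k : ℝ) + 1)) := ENNReal.ofReal_pos.2 (by positivity)
        exact ENNReal.mul_pos (by simp) this.ne'
    have h1 := (hpre_tendsto m (B N)).comp hlim
    have hC : (5 : ℝ≥0∞) ^ m * ((T + 1) / ENNReal.ofReal (1 / ((N : ℝ) + 1))) ≠ ∞ := by
      refine ENNReal.mul_ne_top (by simp) (ENNReal.div_ne_top (by simp) ?_)
      exact (ENNReal.ofReal_pos.2 (by positivity)).ne'
    refine ne_top_of_le_ne_top hC (le_of_tendsto h1 ?_)
    filter_upwards [eventually_ge_atTop N] with k hk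
    refine weighted_cover m (E k) (a k) (ρ k) (hρ0 k) (fun i => (hρ1 k i).trans (hone k)) _
      (fun i => ?_) (hE k) T (by simp) (hsum k) _ (by positivity) (B N) ?_
    · exact mul_le_mul_right (ENNReal.ofReal_le_ofReal (hρ1 k i)) 5
    · intro y hy
      simp only [B, mem_iInter, mem_ofPred_eq] at hy
      exact hy k hk
  set u : Y → ℝ≥0∞ := fun y => liminf (fun k => g k y) atTop with hu
  have hsupp : ∀ y, y ∉ ⋃ N, B N → u y = 0 := by
    intro y hy
    by_contra h0
    apply hy
    have h1 : Tendsto (fun k : ℕ => ENNReal.ofReal (1 / ((k : ℝ) + 1))) atTop (𝓝 0) := by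
      rw [← ENNReal.ofReal_zero]
      exact (ENNReal.continuous_ofReal.tendsto _).comp tendsto_one_div_add_atTop_nhds_zero_nat
    obtain ⟨n0, hn0⟩ := (h1.eventually (gt_mem_nhds (pos_iff_ne_zero.2 h0))).exists
    have h2 := eventually_lt_of_lt_liminf hn0
    obtain ⟨K, hK⟩ := eventually_atTop.1 h2
    refine mem_iUnion.2 ⟨max n0 K, ?_⟩
    simp only [B, mem_iInter, mem_ofPred_eq]
    intro k hk
    refine lt_of_le_of_lt (ENNReal.ofReal_le_ofReal ?_) (hK k ((le_max_right _ _).trans hk))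
    exact Nat.one_div_le_one_div (le_max_left _ _)
  calc ∫⁻ y, u y ∂μ = ∫⁻ y in ⋃ N, B N, u y ∂μ := by
        rw [← lintegral_indicator (MeasurableSet.iUnion hBm)]
        congr 1
        ext y
        by_cases hy : y ∈ ⋃ N, B N
        · rw [indicator_of_mem hy]
        · rw [indicator_of_notMem hy, hsupp y hy]
    _ = ⨆ N, ∫⁻ y in B N, u y ∂μ :=
        setLIntegral_iUnion_of_directed _ hBmono.directed_le
    _ ≤ T := iSup_le fun N => integral_finite m E hEm a ρ hρ1 hE T hsum (B N) (hBm N) (hBfin N)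

theorem Gamma_superadd (a b : ℝ) (ha : 0 ≤ a) (hb : 0 ≤ b) :
    Real.Gamma (a + 1) * Real.Gamma (b + 1) ≤ Real.Gamma (a + b + 1) := by
  rcases (add_nonneg ha hb).eq_or_lt with h | h
  · have h1 : a = 0 := by linarith
    have h2 : b = 0 := by linarith
    simp [h1, h2]
  have key : ∀ c, 0 ≤ c → c ≤ a + b →
      Real.log (Real.Gamma (c + 1)) ≤ c / (a + b) * Real.log (Real.Gamma (a + b + 1)) := by
    intro c hc hcab
    have hm1 : (1 : ℝ) ∈ Ioi (0 : ℝ) := by simp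
    have hm2 : a + b + 1 ∈ Ioi (0 : ℝ) := by simp only [mem_Ioi]; linarith
    have hcv := Real.convexOn_log_Gamma.2
    have := hcv hm1 hm2 (a := 1 - c / (a + b)) (b := c / (a + b))
      (by rw [sub_nonneg, div_le_one h]; exact hcab) (by positivity) (by ring)
    have e : (1 - c / (a + b)) + c / (a + b) * (a + b + 1) = c + 1 := by field_simp; ring
    simpa [e] using this
  have h1 := key a ha (by linarith)
  have h2 := key b hb (by linarith)
  have e : a / (a + b) * Real.log (Real.Gamma (a + b + 1)) +
      b / (a + b) * Real.log (Real.Gamma (a + b + 1)) = Real.log (Real.Gamma (a + b + 1)) := by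
    field_simp
  have pa := Real.Gamma_pos_of_pos (s := a + 1) (by linarith)
  have pb := Real.Gamma_pos_of_pos (s := b + 1) (by linarith)
  have pc := Real.Gamma_pos_of_pos (s := a + b + 1) (by linarith)
  rw [← Real.log_le_log_iff (mul_pos pa pb) pc, Real.log_mul pa.ne' pb.ne']
  linarith

theorem unitBallVol_eq (n : ℕ) :
    unitBallVol n = ENNReal.ofReal (√Real.pi ^ n / Real.Gamma (n / 2 + 1)) := by
  unfold unitBallVol
  rcases Nat.eq_zero_or_pos n with rfl | hn
  · have : Metric.ball (0 : EucSp 0) 1 = univ := by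
      ext x; simp [Subsingleton.elim x 0]
    rw [this]
    have h := (PiLp.volume_preserving_ofLp (Fin 0)).measure_preimage (s := univ)
      nullMeasurableSet_univ
    rw [preimage_univ] at h
    rw [h]
    simp [volume_pi]
  · have : Nonempty (Fin n) := ⟨⟨0, hn⟩⟩
    rw [EuclideanSpace.volume_ball]
    simp

theorem one_le_const (n m : ℕ) (h : m ≤ n) :
    1 ≤ unitBallVol (n - m) * unitBallVol m / unitBallVol n := by
  have hp : ∀ k : ℕ, 0 < √Real.pi ^ k / Real.Gamma (k / 2 + 1) := fun k =>
    div_pos (pow_pos (Real.sqrt_pos.2 Real.pi_pos) _) (Real.Gamma_pos_of_pos (by positivity))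
  rw [ENNReal.le_div_iff_mul_le (Or.inr (by simp only [unitBallVol_eq, ne_eq, mul_eq_zero, not_or, ENNReal.ofReal_eq_zero, not_le]; exact ⟨hp _, hp _⟩))
    (Or.inl (by simp [unitBallVol_eq])), one_mul]
  · rw [unitBallVol_eq, unitBallVol_eq, unitBallVol_eq, ← ENNReal.ofReal_mul (hp _).le]
    refine ENNReal.ofReal_le_ofReal ?_
    rw [div_mul_div_comm, ← pow_add, Nat.sub_add_cancel h]
    have h1 := Gamma_superadd (((n - m : ℕ) : ℝ) / 2) ((m : ℝ) / 2) (by positivity) (by positivity)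
    have e : ((n - m : ℕ) : ℝ) / 2 + (m : ℝ) / 2 + 1 = n / 2 + 1 := by
      rw [Nat.cast_sub h]; ring
    rw [e] at h1
    have pa := Real.Gamma_pos_of_pos (s := ((n - m : ℕ) : ℝ) / 2 + 1) (by positivity)
    have pb := Real.Gamma_pos_of_pos (s := (m : ℝ) / 2 + 1) (by positivity)
    gcongr

theorem exists_cover {X : Type*} [MetricSpace X] [MeasurableSpace X] [BorelSpace X]
    (n : ℕ) (A : Set X) (T : ℝ≥0) (hT : μH[(n : ℝ)] A < T) (θ : ℝ) (hθ : 0 < θ) :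
    ∃ (t : ℕ → Set X) (r : ℕ → ℝ), A ⊆ ⋃ i, t i ∧ (∀ i, 0 < r i ∧ r i ≤ θ ∧
      Metric.ediam (t i) < ENNReal.ofReal (r i)) ∧
      ∑' i, (⨆ _ : (t i).Nonempty, ENNReal.ofReal (r i) ^ n) ≤ T := by
  rw [Measure.hausdorffMeasure_apply] at hT
  have h1 := lt_of_le_of_lt (le_iSup₂ (f := fun (r : ℝ≥0∞) (_ : 0 < r) =>
    ⨅ (t : ℕ → Set X) (_ : A ⊆ ⋃ n, t n) (_ : ∀ n, Metric.ediam (t n) ≤ r),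
      ∑' i, ⨆ _ : (t i).Nonempty, Metric.ediam (t i) ^ (n : ℝ)) (ENNReal.ofReal (θ / 2))
    (ENNReal.ofReal_pos.2 (by positivity))) hT
  simp only [iInf_lt_iff] at h1
  obtain ⟨t, htA, htd, hts⟩ := h1
  obtain ⟨ε, hε0, hε⟩ := ENNReal.exists_pos_sum_of_countable' (tsub_pos_of_lt hts).ne' ℕ
  have hr : ∀ i, ∃ r : ℝ, (0 < r ∧ r ≤ θ ∧ Metric.ediam (t i) < ENNReal.ofReal r) ∧
      ENNReal.ofReal r ^ n ≤ Metric.ediam (t i) ^ n + ε i := by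
    intro i
    have hfin : Metric.ediam (t i) ≠ ∞ := ne_top_of_le_ne_top ENNReal.ofReal_ne_top (htd i)
    set d := (Metric.ediam (t i)).toReal with hd
    have hdd : Metric.ediam (t i) = ENNReal.ofReal d := (ENNReal.ofReal_toReal hfin).symm
    have hd0 : 0 ≤ d := ENNReal.toReal_nonneg
    have hdθ : d ≤ θ / 2 := by
      have := htd i
      rw [hdd] at this
      exact (ENNReal.ofReal_le_ofReal_iff (by positivity)).1 this
    have hlim : Tendsto (fun x : ℝ => ENNReal.ofReal x ^ n) (𝓝[>] d) (𝓝 (ENNReal.ofReal d ^ n)) :=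
      (((ENNReal.continuous_pow n).comp ENNReal.continuous_ofReal).tendsto d).mono_left
        nhdsWithin_le_nhds
    have hlt : ENNReal.ofReal d ^ n < ENNReal.ofReal d ^ n + ε i :=
      ENNReal.lt_add_right (by simp) (hε0 i).ne'
    obtain ⟨r, hr1, hr2⟩ := ((hlim.eventually (gt_mem_nhds hlt)).and
      (Ioo_mem_nhdsGT (show d < d + θ / 2 by linarith))).exists
    refine ⟨r, ⟨by linarith [hr2.1], by linarith [hr2.2], ?_⟩, ?_⟩
    · rw [hdd]
      exact (ENNReal.ofReal_lt_ofReal_iff (by linarith [hr2.1])).2 hr2.1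
    · rw [hdd]; exact hr1.le
  choose r hr1 hr2 using hr
  refine ⟨t, r, htA, hr1, ?_⟩
  calc ∑' i, (⨆ _ : (t i).Nonempty, ENNReal.ofReal (r i) ^ n)
      ≤ ∑' i, ((⨆ _ : (t i).Nonempty, Metric.ediam (t i) ^ (n : ℝ)) + ε i) := by
        refine ENNReal.tsum_le_tsum fun i => iSup_le fun h => ?_
        refine (hr2 i).trans ?_
        simp [h]
    _ = (∑' i, ⨆ _ : (t i).Nonempty, Metric.ediam (t i) ^ (n : ℝ)) + ∑' i, ε i :=
        ENNReal.tsum_add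
    _ ≤ (∑' i, ⨆ _ : (t i).Nonempty, Metric.ediam (t i) ^ (n : ℝ)) +
        (T - ∑' i, ⨆ _ : (t i).Nonempty, Metric.ediam (t i) ^ (n : ℝ)) := by gcongr
    _ = T := add_tsub_cancel_of_le hts.le

theorem coarea_main {X Y : Type*} [MetricSpace X] [MeasurableSpace X] [BorelSpace X]
    [MetricSpace Y] [MeasurableSpace Y] [BorelSpace Y]
    (f : X → Y) (L : ℝ≥0) (hL : 0 < L) (hf : LipschitzWith L f)
    (A : Set X) (p m : ℕ) (T : ℝ≥0) (hT : μH[((p + m : ℕ) : ℝ)] A < T) :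
    upperLintegral (μH[(m : ℝ)] : Measure Y)
        (fun y => μH[(p : ℝ)] (f ⁻¹' {y} ∩ A)) ≤ (L : ℝ≥0∞) ^ m * T := by
  have hθ : ∀ k : ℕ, 0 < 1 / ((k : ℝ) + 1) / (1 + L) := fun k => by positivity
  choose t r htA hr hsum using fun k : ℕ => exists_cover (p + m) A T hT _ (hθ k)
  let η : ℕ → ℕ → ℝ≥0 := fun k i => L * ((ENNReal.ofReal (r k i)).toNNReal
    - (Metric.ediam (t k i)).toNNReal) / 2
  let E : ℕ → ℕ → Set Y := fun k i => Metric.thickening (η k i) (f '' t k i)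
  let a : ℕ → ℕ → ℝ≥0∞ := fun k i => ⨆ _ : (t k i).Nonempty, ENNReal.ofReal (r k i) ^ p
  let ρ : ℕ → ℕ → ℝ := fun k i => L * r k i
  have hL' : (0 : ℝ) < L := hL
  have hdt : ∀ k i, Metric.ediam (t k i) ≠ ∞ := fun k i => ne_top_of_lt (hr k i).2.2
  have hη : ∀ k i, 0 < η k i := by
    intro k i
    have : (Metric.ediam (t k i)).toNNReal < (ENNReal.ofReal (r k i)).toNNReal :=
      ENNReal.toNNReal_strict_mono ENNReal.ofReal_ne_top (hr k i).2.2
    have h2 := tsub_pos_of_lt this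
    positivity
  have hE : ∀ k i, Metric.ediam (E k i) ≤ ENNReal.ofReal (ρ k i) := by
    intro k i
    have h1 : Metric.ediam (E k i) ≤ L * Metric.ediam (t k i) + 2 * η k i :=
      (Metric.ediam_thickening_le (η k i)).trans (by gcongr; exact hf.ediam_image_le _)
    refine h1.trans (le_of_eq ?_)
    have h3 : (Metric.ediam (t k i)).toNNReal ≤ (ENNReal.ofReal (r k i)).toNNReal :=
      ENNReal.toNNReal_mono ENNReal.ofReal_ne_top (hr k i).2.2.le
    rw [ENNReal.ofReal_mul hL'.le, ENNReal.ofReal_coe_nnreal]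
    simp only [η]
    have e1 : Metric.ediam (t k i) = ((Metric.ediam (t k i)).toNNReal : ℝ≥0∞) :=
      (ENNReal.coe_toNNReal (hdt k i)).symm
    have e2 : ENNReal.ofReal (r k i) = ((ENNReal.ofReal (r k i)).toNNReal : ℝ≥0∞) :=
      (ENNReal.coe_toNNReal ENNReal.ofReal_ne_top).symm
    generalize (Metric.ediam (t k i)).toNNReal = d at *
    generalize (ENNReal.ofReal (r k i)).toNNReal = R at *
    rw [e1, e2]
    norm_cast
    rw [← NNReal.coe_inj]
    push_cast [NNReal.coe_sub h3]
    ring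
  have hB := integral_bound m E (fun k i => Metric.isOpen_thickening.measurableSet) a ρ
    (fun k i => mul_pos hL' (hr k i).1) (fun k i => ?_) hE (L ^ m * T) (fun k => ?_)
  · unfold upperLintegral
    have hmeas : Measurable fun y => liminf
        (fun k => ∑' i, (E k i).indicator (fun _ => a k i) y) atTop :=
      Measurable.liminf fun k => Measurable.tsum fun i =>
        measurable_const.indicator Metric.isOpen_thickening.measurableSet
    have hB' := hB.trans (show ((L ^ m * T : ℝ≥0) : ℝ≥0∞) ≤ (L : ℝ≥0∞) ^ m * T by
      push_cast; exact le_rfl)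
    refine iInf_le_of_le _ (iInf_le_of_le hmeas (iInf_le_of_le ?_ hB'))
    intro y
    have hlim : Tendsto (fun k : ℕ => ENNReal.ofReal (1 / ((k : ℝ) + 1))) atTop (𝓝[>] 0) := by
      refine tendsto_nhdsWithin_iff.2 ⟨?_, Eventually.of_forall fun k =>
        ENNReal.ofReal_pos.2 (by positivity)⟩
      rw [← ENNReal.ofReal_zero]
      exact (ENNReal.continuous_ofReal.tendsto _).comp tendsto_one_div_add_atTop_nhds_zero_nat
    have h1 := (hpre_tendsto p (f ⁻¹' {y} ∩ A)).comp hlim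
    beta_reduce
    rw [← h1.liminf_eq]
    refine liminf_le_liminf (Eventually.of_forall fun k => ?_)
    have hsub : f ⁻¹' {y} ∩ A ⊆ ⋃ i, (f ⁻¹' {y} ∩ t k i) := by
      rw [← inter_iUnion]
      exact inter_subset_inter_right _ (htA k)
    refine (measure_mono hsub).trans ((measure_iUnion_le _).trans (ENNReal.tsum_le_tsum fun i => ?_))
    rcases (f ⁻¹' {y} ∩ t k i).eq_empty_or_nonempty with h | h
    · simp [h]
    · obtain ⟨x, hx, hxt⟩ := h
      have hyE : y ∈ E k i := by
        refine Metric.self_subset_thickening (by exact_mod_cast hη k i) _ ⟨x, hxt, hx⟩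
      have hne : (t k i).Nonempty := ⟨x, hxt⟩
      change _ ≤ (E k i).indicator (fun _ => a k i) y
      rw [indicator_of_mem hyE]
      simp only [a, hne, iSup_true, iSup_pos]
      have hd : Metric.ediam (f ⁻¹' {y} ∩ t k i) ≤ ENNReal.ofReal (r k i) :=
        (Metric.ediam_mono inter_subset_right).trans (hr k i).2.2.le
      refine (hpre_le p _ _ (hd.trans (ENNReal.ofReal_le_ofReal ?_))).trans (by gcongr)
      refine (hr k i).2.1.trans (div_le_self (by positivity) (by linarith))
  · calc ρ k i = L * r k i := rfl
      _ ≤ (1 + L) * (1 / ((k : ℝ) + 1) / (1 + L)) := by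
        gcongr
        · exact (hr k i).1.le
        · linarith
        · exact (hr k i).2.1
      _ = _ := by field_simp
  · calc ∑' i, a k i * ENNReal.ofReal (ρ k i) ^ m
        = ∑' i, (L : ℝ≥0∞) ^ m * (⨆ _ : (t k i).Nonempty, ENNReal.ofReal (r k i) ^ (p + m)) := by
          congr 1
          ext i
          simp only [a, ρ]
          rw [ENNReal.ofReal_mul hL'.le, ENNReal.ofReal_coe_nnreal]
          by_cases h : (t k i).Nonempty
          · simp only [h, iSup_pos]; ring
          · simp [h]
      _ = (L : ℝ≥0∞) ^ m * ∑' i, (⨆ _ : (t k i).Nonempty, ENNReal.ofReal (r k i) ^ (p + m)) :=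
          ENNReal.tsum_mul_left
      _ ≤ _ := by push_cast; gcongr; exact hsum k

theorem coarea_pos {X Y : Type*} [MetricSpace X] [MeasurableSpace X] [BorelSpace X]
    [MetricSpace Y] [MeasurableSpace Y] [BorelSpace Y]
    (f : X → Y) (L : ℝ≥0) (hL : 0 < L) (hf : LipschitzWith L f)
    (A : Set X) (p m : ℕ) :
    upperLintegral (μH[(m : ℝ)] : Measure Y)
        (fun y => μH[(p : ℝ)] (f ⁻¹' {y} ∩ A)) ≤
      (L : ℝ≥0∞) ^ m * μH[((p + m : ℕ) : ℝ)] A := by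
  have hLm : (L : ℝ≥0∞) ^ m ≠ 0 := pow_ne_zero _ (by simpa using hL.ne')
  by_cases htop : (μH[((p + m : ℕ) : ℝ)] : Measure X) A = ∞
  · rw [htop, ENNReal.mul_top hLm]; exact le_top
  generalize hH : (μH[((p + m : ℕ) : ℝ)] : Measure X) A = H at *
  lift H to ℝ≥0 using htop
  have hlim : Tendsto (fun T : ℝ≥0 => (L : ℝ≥0∞) ^ m * (T : ℝ≥0∞)) (𝓝[>] H)
      (𝓝 ((L : ℝ≥0∞) ^ m * H)) :=
    ENNReal.Tendsto.const_mul ((ENNReal.continuous_coe.tendsto H).mono_left nhdsWithin_le_nhds)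
      (Or.inr (by simp))
  refine ge_of_tendsto hlim ?_
  filter_upwards [self_mem_nhdsWithin] with T hT
  refine coarea_main f L hL hf A p m T ?_
  rw [hH]
  exact_mod_cast hT

/-- coarea inequality, Federer/Davies: for a Lipschitz map
`f : X → Y` between metric spaces, `A ⊆ X` and `0 ≤ m ≤ n`,
`∫*_Y ℋ^{n−m}(f⁻¹(y) ∩ A) dℋ^m(y) ≤ (Lip f)^m (ω_{n−m} ω_m / ω_n) ℋ^n(A)`. -/
theorem stmt16 {X Y : Type*} [MetricSpace X] [MeasurableSpace X] [BorelSpace X]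
    [MetricSpace Y] [MeasurableSpace Y] [BorelSpace Y]
    (f : X → Y) (L : ℝ≥0) (hf : LipschitzWith L f)
    (A : Set X) (n m : ℕ) (hmn : m ≤ n) :
    upperLintegral (μH[(m : ℝ)] : Measure Y)
        (fun y => μH[((n - m : ℕ) : ℝ)] (f ⁻¹' {y} ∩ A)) ≤
      (L : ℝ≥0∞) ^ m * (unitBallVol (n - m) * unitBallVol m / unitBallVol n) *
        μH[(n : ℝ)] A := by
  obtain ⟨p, rfl⟩ : ∃ p, n = p + m := ⟨n - m, (Nat.sub_add_cancel hmn).symm⟩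
  have hc := one_le_const (p + m) m hmn
  rw [Nat.add_sub_cancel] at hc ⊢
  have hle : ∀ K : ℝ≥0, (K : ℝ≥0∞) ^ m * μH[((p + m : ℕ) : ℝ)] A ≤
      (K : ℝ≥0∞) ^ m * (unitBallVol p * unitBallVol m / unitBallVol (p + m)) *
        μH[((p + m : ℕ) : ℝ)] A := by
    intro K
    gcongr
    exact le_mul_of_one_le_right' hc
  rcases eq_or_ne L 0 with rfl | hL
  · rcases Nat.eq_zero_or_pos m with rfl | hm
    · refine (coarea_pos f 1 one_pos (hf.weaken zero_le) A p 0).trans ((hle 1).trans ?_)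
      simp
    · -- `f` is constant and points are null
      rcases isEmpty_or_nonempty X with hX | ⟨⟨x0⟩⟩
      · unfold upperLintegral
        refine iInf_le_of_le (fun _ => 0) (iInf_le_of_le measurable_const (iInf_le_of_le ?_ ?_))
        · intro y
          simp [Set.eq_empty_of_isEmpty]
        · simp
      · have hconst : ∀ x, f x = f x0 := fun x => by
          have := hf x x0
          simpa using this
        have hm' : (0 : ℝ) < m := by exact_mod_cast hm
        have := Measure.nullSingletonClass_hausdorff Y hm'
        unfold upperLintegral
        refine iInf_le_of_le (({f x0} : Set Y).indicator fun _ => ∞) (iInf_le_of_le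
          (measurable_const.indicator (measurableSet_singleton _)) (iInf_le_of_le ?_ ?_))
        · intro y
          by_cases hy : y = f x0
          · simp [hy]
          · have : f ⁻¹' {y} = ∅ := by
              ext x; simp [hconst x, Ne.symm hy]
            simp [this]
        · rw [lintegral_indicator_const (measurableSet_singleton _)]
          simp
  · exact (coarea_pos f L (pos_iff_ne_zero.2 hL) hf A p m).trans (hle L)

end
end

section
/- Let f : X → Y be a Lipschitz map between metric spaces, A ⊂ X with ℋ^n(A) = 0, and 0 ≤ m ≤ n. Then ℋ^{n−m}(f⁻¹(y) ∩ A) = 0 for ℋ^m-almost every y ∈ Y. -/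
open MeasureTheory Metric Set Filter
open scoped ENNReal NNReal Topology

noncomputable section

lemma exists_sub_vol (U : Set ℝ) (hU : MeasurableSet U) (hUI : U ⊆ Icc 0 1) (c : ℝ≥0∞) :
    ∃ S, S ⊆ U ∧ MeasurableSet S ∧ volume S ≤ c ∧ (volume S < c → S = U) := by
  by_cases hc : volume U ≤ c
  · exact ⟨U, Subset.rfl, hU, hc, fun _ => rfl⟩
  push Not at hc
  have hfin : ∀ V : Set ℝ, V ⊆ Icc 0 1 → volume V ≠ ∞ := fun V hV =>
    ((measure_mono hV).trans_lt (by simp)).ne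
  have hcfin : c ≠ ∞ := (hc.trans_le le_top).ne
  let g : ℝ → ℝ := fun x => (volume (U ∩ Iic x)).toReal
  have hgf : ∀ x, volume (U ∩ Iic x) ≠ ∞ := fun x => hfin _ (inter_subset_left.trans hUI)
  have hg : LipschitzWith 1 g := by
    apply LipschitzWith.of_le_add
    intro x y
    rcases le_total x y with h | h
    · have : g x ≤ g y := ENNReal.toReal_mono (hgf y)
        (measure_mono (inter_subset_inter_right _ (Iic_subset_Iic.2 h)))
      linarith [dist_nonneg (x := x) (y := y)]
    · have h1 : volume (U ∩ Iic x) ≤ volume (U ∩ Iic y) + volume (Ioc y x) := by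
        refine (measure_mono ?_).trans (measure_union_le _ _)
        rintro z ⟨hz, hzx⟩
        by_cases hzy : z ≤ y
        · exact Or.inl ⟨hz, hzy⟩
        · exact Or.inr ⟨not_le.1 hzy, hzx⟩
      have h2 := ENNReal.toReal_mono (by simp [hgf y]) h1
      rw [ENNReal.toReal_add (hgf y) (by simp), Real.volume_Ioc,
        ENNReal.toReal_ofReal (by linarith)] at h2
      rw [Real.dist_eq, abs_of_nonneg (by linarith)]
      exact h2
  have h0 : g 0 = 0 := by
    have : volume (U ∩ Iic 0) = 0 := by
      refine measure_mono_null (t := {0}) ?_ (by simp)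
      rintro z ⟨hz, hz0⟩
      exact le_antisymm hz0 (hUI hz).1
    simp [g, this]
  have h1 : g 1 = (volume U).toReal := by
    have : U ∩ Iic 1 = U := inter_eq_left.2 fun z hz => (hUI hz).2
    simp [g, this]
  have := intermediate_value_Icc (zero_le_one' ℝ) hg.continuous.continuousOn
  obtain ⟨x, -, hx⟩ := this (show c.toReal ∈ Icc (g 0) (g 1) by
    rw [h0, h1]
    exact ⟨ENNReal.toReal_nonneg, ENNReal.toReal_mono (hfin U hUI) hc.le⟩)
  have hx' : volume (U ∩ Iic x) = c := (ENNReal.toReal_eq_toReal_iff' (hgf x) hcfin).1 hx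
  exact ⟨U ∩ Iic x, inter_subset_left, hU.inter measurableSet_Iic, hx'.le,
    fun h => absurd hx' h.ne⟩

lemma weighted_cover_s17 {Y : Type*} (E : ℕ → Set Y) (ρ : ℕ → ℕ) (c w : ℕ → ℝ≥0∞) (B : Set Y)
    (hB : ∀ y ∈ B, 1 < ∑' i, (E i).indicator (fun _ => c i) y) :
    ∃ G : Set ℕ, ∑' i, G.indicator w i ≤ ∑' i, c i * w i ∧
      ∀ y ∈ B, ∃ i, y ∈ E i ∧ ∃ j ∈ G, ρ j ≤ ρ i ∧ (E i ∩ E j).Nonempty := by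
  classical
  choose! T hT1 hT2 hT3 hT4 using exists_sub_vol
  let key : ℕ → ℕ ×ₗ ℕ := fun i => toLex (ρ i, i)
  let r : ℕ → ℕ → Prop := fun j i => key j < key i
  have hr : WellFounded r := InvImage.wf key wellFounded_lt
  let F : (i : ℕ) → ((j : ℕ) → r j i → Set ℝ) → Set ℝ := fun i S =>
    T (Icc 0 1 \ ⋃ j, ⋃ h : r j i ∧ (E i ∩ E j).Nonempty, S j h.1) (c i)
  let S : ℕ → Set ℝ := hr.fix F
  let U : ℕ → Set ℝ := fun i => Icc 0 1 \ ⋃ j, ⋃ _ : r j i ∧ (E i ∩ E j).Nonempty, S j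
  have hS : ∀ i, S i = T (U i) (c i) := fun i => hr.fix_eq F i
  have hUI : ∀ i, U i ⊆ Icc 0 1 := fun i => sdiff_subset
  have hUm : ∀ i, MeasurableSet (U i) := by
    intro i
    induction i using hr.induction with
    | _ i ih =>
      refine measurableSet_Icc.diff (MeasurableSet.iUnion fun j => MeasurableSet.iUnion fun h => ?_)
      rw [hS j]
      exact hT2 _ (ih j h.1) (hUI j) _
  have hSU : ∀ i, S i ⊆ U i := fun i => by rw [hS]; exact hT1 _ (hUm i) (hUI i) _
  have hSm : ∀ i, MeasurableSet (S i) := fun i => by rw [hS]; exact hT2 _ (hUm i) (hUI i) _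
  have hSc : ∀ i, volume (S i) ≤ c i := fun i => by rw [hS]; exact hT3 _ (hUm i) (hUI i) _
  have hSeq : ∀ i, volume (S i) < c i → S i = U i := fun i => by
    rw [hS]; exact hT4 _ (hUm i) (hUI i) _
  have hdis0 : ∀ i j, r j i → (E i ∩ E j).Nonempty → Disjoint (S j) (S i) := by
    intro i j hji hne
    rw [Set.disjoint_left]
    intro θ h1 h2
    exact (hSU i h2).2 (mem_iUnion.2 ⟨j, mem_iUnion.2 ⟨⟨hji, hne⟩, h1⟩⟩)
  have hdis : ∀ i j, i ≠ j → (E i ∩ E j).Nonempty → Disjoint (S i) (S j) := by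
    intro i j hij hne
    rcases lt_trichotomy (key i) (key j) with h | h | h
    · exact hdis0 j i h (by rwa [inter_comm])
    · exact absurd (congrArg (fun p => (ofLex p).2) h) hij
    · exact (hdis0 i j h hne).symm
  -- choose the level
  obtain ⟨θ, hθ, hle⟩ : ∃ θ ∈ Icc (0:ℝ) 1,
      ∑' i, (S i).indicator (fun _ => w i) θ ≤ ∑' i, c i * w i := by
    have hm : AEMeasurable (fun θ => ∑' i, (S i).indicator (fun _ => w i) θ)
        (volume.restrict (Icc (0:ℝ) 1)) :=
      (Measurable.tsum fun i => measurable_const.indicator (hSm i)).aemeasurable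
    obtain ⟨θ, hθ, h⟩ := exists_le_setLAverage (μ := volume) (s := Icc (0:ℝ) 1)
      (by simp) (by simp) hm
    refine ⟨θ, hθ, h.trans ?_⟩
    rw [setLAverage_eq, Real.volume_Icc]
    simp only [sub_zero, ENNReal.ofReal_one, div_one]
    rw [lintegral_tsum fun i => (measurable_const.indicator (hSm i)).aemeasurable]
    refine ENNReal.tsum_le_tsum fun i => ?_
    refine (setLIntegral_le_lintegral _ _).trans ?_
    rw [lintegral_indicator_const (hSm i), mul_comm]
    gcongr
    exact hSc i
  refine ⟨{i | θ ∈ S i}, ?_, ?_⟩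
  · simpa [indicator] using hle
  · intro y hy
    obtain ⟨i, hyi, hi⟩ : ∃ i, y ∈ E i ∧ volume (S i) < c i := by
      by_contra! hcon
      have h1 : ∑' i, (E i).indicator (fun _ => c i) y
          ≤ ∑' i, volume (if y ∈ E i then S i else ∅) := by
        refine ENNReal.tsum_le_tsum fun i => ?_
        by_cases h : y ∈ E i
        · simp [h, hcon i h]
        · simp [h]
      rw [← measure_iUnion] at h1
      · have h2 : volume (⋃ i, if y ∈ E i then S i else ∅) ≤ volume (Icc (0:ℝ) 1) := by
          refine measure_mono (iUnion_subset fun i => ?_)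
          split_ifs
          · exact (hSU i).trans (hUI i)
          · simp
        have h3 := (hB y hy).trans_le (h1.trans h2)
        simp at h3
      · intro i j hij
        simp only [Function.onFun]
        split_ifs with h1 h2
        · exact hdis i j hij ⟨y, h1, h2⟩
        all_goals simp
      · intro i
        split_ifs
        · exact hSm i
        · simp
    refine ⟨i, hyi, ?_⟩
    by_cases hθi : θ ∈ S i
    · exact ⟨i, hθi, le_rfl, y, hyi, hyi⟩
    · rw [hSeq i hi] at hθi
      have : θ ∈ ⋃ j, ⋃ _ : r j i ∧ (E i ∩ E j).Nonempty, S j := by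
        by_contra h
        exact hθi ⟨hθ, h⟩
      simp only [mem_iUnion] at this
      obtain ⟨j, ⟨hji, hne⟩, hj⟩ := this
      refine ⟨j, hj, ?_, hne⟩
      rcases Prod.Lex.lt_iff.1 hji with h | h
      · exact h.le
      · exact h.1.le

lemma null_cover {X : Type*} [MetricSpace X] [MeasurableSpace X] [BorelSpace X]
    (A : Set X) (n : ℝ) (hn : 0 < n) (hA : μH[n] A = 0) (δ ε : ℝ≥0∞) (hδ : 0 < δ) (hε : ε ≠ 0) :
    ∃ (t : ℕ → Set X) (e : ℕ → ℝ≥0∞), A ⊆ ⋃ i, t i ∧ (∀ i, ediam (t i) ≤ e i) ∧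
      (∀ i, 0 < e i) ∧ (∀ i, e i ≤ δ) ∧ ∑' i, e i ^ n ≤ ε := by
  have hε2 : ε / 2 ≠ 0 := by simp [hε]
  rw [Measure.hausdorffMeasure_apply] at hA
  simp only [ENNReal.iSup_eq_zero] at hA
  have h := hA δ hδ
  have h' := h.trans_lt (pos_iff_ne_zero.2 hε2)
  simp only [iInf_lt_iff] at h'
  obtain ⟨t, ht, hd, hsum⟩ := h'
  obtain ⟨η, hη, hηs⟩ := ENNReal.exists_pos_sum_of_countable' hε2 ℕ
  refine ⟨t, fun i => min δ ((ediam (t i) ^ n + η i) ^ (n⁻¹)), ht, ?_, ?_, ?_, ?_⟩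
  · intro i
    refine le_min (hd i) ?_
    calc ediam (t i) = (ediam (t i) ^ n) ^ (n⁻¹) := by
          rw [ENNReal.rpow_rpow_inv hn.ne']
      _ ≤ _ := by gcongr; exact le_self_add
  · intro i
    refine lt_min hδ ?_
    apply ENNReal.rpow_pos_of_nonneg _ (by positivity)
    exact (hη i).trans_le le_add_self
  · exact fun i => min_le_left _ _
  · calc ∑' i, (min δ ((ediam (t i) ^ n + η i) ^ (n⁻¹))) ^ n
        ≤ ∑' i, ((⨆ _ : (t i).Nonempty, ediam (t i) ^ n) + η i) := by
          refine ENNReal.tsum_le_tsum fun i => ?_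
          calc (min δ ((ediam (t i) ^ n + η i) ^ (n⁻¹))) ^ n
              ≤ ((ediam (t i) ^ n + η i) ^ (n⁻¹)) ^ n := by
                gcongr; exact min_le_right _ _
            _ = ediam (t i) ^ n + η i := ENNReal.rpow_inv_rpow hn.ne' _
            _ ≤ _ := by
                gcongr
                rcases (t i).eq_empty_or_nonempty with h | h
                · simp [h, hn]
                · simp [h]
      _ ≤ ε / 2 + ε / 2 := by
          rw [ENNReal.tsum_add]
          exact add_le_add hsum.le hηs.le
      _ = ε := ENNReal.add_halves ε

lemma exists_rank (e : ℝ≥0∞) (h0 : 0 < e) (h1 : e ≤ 1) :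
    ∃ k : ℕ, (2⁻¹ : ℝ≥0∞) ^ (k + 1) < e ∧ e ≤ 2⁻¹ ^ k := by
  have hf : e ≠ ∞ := (h1.trans_lt ENNReal.one_lt_top).ne
  lift e to ℝ≥0 using hf
  obtain ⟨k, hk⟩ := exists_nat_pow_near_of_lt_one (x := e) (y := (2⁻¹ : ℝ≥0))
    (by exact_mod_cast h0) (by exact_mod_cast h1) (by positivity)
    (by rw [← one_div]; exact NNReal.half_lt_self one_ne_zero)
  refine ⟨k, ?_, ?_⟩
  · have := ENNReal.coe_lt_coe.2 hk.1
    rw [ENNReal.coe_pow, ENNReal.coe_inv_two] at this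
    exact this
  · have := ENNReal.coe_le_coe.2 hk.2
    rw [ENNReal.coe_pow, ENNReal.coe_inv_two] at this
    exact this

lemma dyadic_rank_le {a b : ℝ≥0∞} {p q : ℕ} (h : q ≤ p) (ha : a ≤ 2⁻¹ ^ p)
    (hb : (2⁻¹ : ℝ≥0∞) ^ (q + 1) < b) : a ≤ 2 * b := by
  calc a ≤ 2⁻¹ ^ p := ha
    _ ≤ 2⁻¹ ^ q := pow_le_pow_right_of_le_one' (by simp) h
    _ = 2 * 2⁻¹ ^ (q + 1) := by
      rw [pow_succ, mul_comm, mul_assoc, ENNReal.inv_mul_cancel (by simp) (by simp), mul_one]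
    _ ≤ 2 * b := by gcongr

lemma bad_null {X Y : Type*} [MetricSpace X] [MeasurableSpace X] [BorelSpace X]
    [MetricSpace Y] [MeasurableSpace Y] [BorelSpace Y]
    (f : X → Y) (L : ℝ≥0) (hf : LipschitzWith L f)
    (A : Set X) (n m : ℝ) (hm : 0 ≤ m) (hmn : m < n) (hA : μH[n] A = 0)
    (a : ℝ≥0∞) (ha : a ≠ 0) (ha1 : a ≤ 1) (B : Set Y)
    (hB : ∀ y ∈ B, ∀ t : ℕ → Set X, f ⁻¹' {y} ∩ A ⊆ ⋃ i, t i → (∀ i, ediam (t i) ≤ a) →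
      a ≤ ∑' i, ⨆ _ : (t i).Nonempty, ediam (t i) ^ (n - m)) :
    μH[m] B = 0 := by
  have hn : 0 < n := hm.trans_lt hmn
  have hs : 0 < n - m := by linarith
  have haf : a ≠ ∞ := (ha1.trans_lt ENNReal.one_lt_top).ne
  set M : ℝ≥0∞ := ((L + 1 : ℝ≥0) : ℝ≥0∞) with hM
  have hM0 : M ≠ 0 := by simp [hM]
  have hMf : M ≠ ∞ := ENNReal.coe_ne_top
  have h5M0 : 5 * M ≠ 0 := by simp [hM0]
  have h5Mf : 5 * M ≠ ∞ := ENNReal.mul_ne_top (by simp) hMf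
  have hLM : (L : ℝ≥0∞) ≤ M := ENNReal.coe_le_coe.2 le_self_add
  have hKf : (5 * M) ^ m * (2 / a) ≠ ∞ :=
    ENNReal.mul_ne_top (ENNReal.rpow_ne_top_of_nonneg hm h5Mf) (ENNReal.div_ne_top (by simp) ha)
  have main : ∀ (r : ℝ≥0∞), 0 < r → ∀ ε : ℝ≥0∞, ε ≠ 0 →
      ∃ t : ℕ → Set Y, B ⊆ ⋃ i, t i ∧ (∀ i, ediam (t i) ≤ r) ∧
        ∑' i, (⨆ _ : (t i).Nonempty, ediam (t i) ^ m) ≤ (5 * M) ^ m * (2 / a) * ε := by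
    intro r hr ε hε
    obtain ⟨t, e, htA, hte, he0, heδ, hsum⟩ := null_cover A n hn hA (min a (r / (5 * M))) ε
      (lt_min (pos_iff_ne_zero.2 ha) (ENNReal.div_pos hr.ne' h5Mf)) hε
    have hea : ∀ i, e i ≤ a := fun i => (heδ i).trans (min_le_left _ _)
    have her : ∀ i, 5 * M * e i ≤ r := fun i => by
      rw [mul_comm]
      exact (ENNReal.le_div_iff_mul_le (Or.inl h5M0) (Or.inl h5Mf)).1
        ((heδ i).trans (min_le_right _ _))
    have hef : ∀ i, e i ≠ ∞ := fun i => ((hea i).trans_lt haf.lt_top).ne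
    choose ρ hρ1 hρ2 using fun i => exists_rank (e i) (he0 i) ((hea i).trans ha1)
    obtain ⟨G, hG, hcov⟩ := weighted_cover_s17 (fun i => f '' t i) ρ
      (fun i => 2 / a * e i ^ (n - m)) (fun i => e i ^ m) B (by
        intro y hy
        have h1 := hB y hy (fun i => f ⁻¹' {y} ∩ t i)
          (by
            rintro x ⟨hx, hxA⟩
            obtain ⟨i, hi⟩ := mem_iUnion.1 (htA hxA)
            exact mem_iUnion.2 ⟨i, hx, hi⟩)
          (fun i => (ediam_mono inter_subset_right).trans ((hte i).trans (hea i)))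
        have h2 : a ≤ ∑' i, (f '' t i).indicator (fun _ => e i ^ (n - m)) y := by
          refine h1.trans (ENNReal.tsum_le_tsum fun i => iSup_le fun hne => ?_)
          obtain ⟨x, hx, hxt⟩ := hne
          rw [indicator_of_mem (show y ∈ f '' t i from ⟨x, hxt, hx⟩)]
          gcongr
          exact (ediam_mono inter_subset_right).trans (hte i)
        have h3 : ∑' i, (f '' t i).indicator (fun _ => 2 / a * e i ^ (n - m)) y
            = 2 / a * ∑' i, (f '' t i).indicator (fun _ => e i ^ (n - m)) y := by
          rw [← ENNReal.tsum_mul_left]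
          congr 1; ext i
          by_cases h : y ∈ f '' t i
          · rw [indicator_of_mem h, indicator_of_mem h]
          · rw [indicator_of_notMem h, indicator_of_notMem h, mul_zero]
        rw [h3]
        calc (1 : ℝ≥0∞) < 2 := ENNReal.one_lt_two
          _ = 2 / a * a := (ENNReal.div_mul_cancel ha haf).symm
          _ ≤ _ := by gcongr)
    let V : ℕ → Set Y := fun j => {y | ∃ z ∈ f '' t j, edist y z ≤ 2 * M * e j}
    have hft : ∀ i, ediam (f '' t i) ≤ M * e i := fun i =>
      (hf.ediam_image_le _).trans (mul_le_mul' hLM (hte i))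
    have hVd : ∀ j, ediam (V j) ≤ 5 * M * e j := by
      intro j
      refine ediam_le fun y hy y' hy' => ?_
      obtain ⟨z, hz, hyz⟩ := hy
      obtain ⟨z', hz', hyz'⟩ := hy'
      calc edist y y' ≤ edist y z + edist z z' + edist z' y' := edist_triangle4 _ _ _ _
        _ ≤ 2 * M * e j + M * e j + 2 * M * e j := by
            gcongr
            · exact (edist_le_ediam_of_mem hz hz').trans (hft j)
            · rwa [edist_comm]
        _ = 5 * M * e j := by ring
    classical
    refine ⟨fun j => if j ∈ G then V j else ∅, ?_, ?_, ?_⟩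
    · intro y hy
      obtain ⟨i, hyi, j, hjG, hρ, z, hzi, hzj⟩ := hcov y hy
      refine mem_iUnion.2 ⟨j, ?_⟩
      simp only [hjG, if_true]
      refine ⟨z, hzj, ?_⟩
      calc edist y z ≤ M * e i := (edist_le_ediam_of_mem hyi hzi).trans (hft i)
        _ ≤ M * (2 * e j) := by gcongr; exact dyadic_rank_le hρ (hρ2 i) (hρ1 j)
        _ = 2 * M * e j := by ring
    · intro j
      dsimp only
      split_ifs
      · exact (hVd j).trans (her j)
      · simp
    · calc ∑' j, (⨆ _ : (if j ∈ G then V j else ∅).Nonempty, ediam (if j ∈ G then V j else ∅) ^ m)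
          ≤ ∑' j, (5 * M) ^ m * G.indicator (fun i => e i ^ m) j := by
            refine ENNReal.tsum_le_tsum fun j => iSup_le fun hne => ?_
            by_cases hj : j ∈ G
            · simp only [hj, if_true, indicator_of_mem]
              rw [← ENNReal.mul_rpow_of_nonneg _ _ hm]
              gcongr
              exact hVd j
            · simp [hj] at hne
        _ = (5 * M) ^ m * ∑' j, G.indicator (fun i => e i ^ m) j := ENNReal.tsum_mul_left
        _ ≤ (5 * M) ^ m * ∑' i, 2 / a * e i ^ (n - m) * e i ^ m := by gcongr
        _ = (5 * M) ^ m * (2 / a) * ∑' i, e i ^ n := by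
            rw [mul_assoc, ← ENNReal.tsum_mul_left (a := 2 / a)]
            congr 2; ext i
            rw [mul_assoc, ← ENNReal.rpow_add _ _ (he0 i).ne' (hef i), sub_add_cancel]
        _ ≤ _ := by gcongr
  rw [Measure.hausdorffMeasure_apply]
  simp only [ENNReal.iSup_eq_zero]
  intro r hr
  by_contra hne
  set I := ⨅ (t : ℕ → Set Y) (_ : B ⊆ ⋃ n, t n) (_ : ∀ n, ediam (t n) ≤ r),
          ∑' n, ⨆ _ : (t n).Nonempty, ediam (t n) ^ m with hI
  obtain ⟨ε, hε, hlt⟩ := ENNReal.exists_pos_mul_lt hKf hne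
  obtain ⟨t, h1, h2, h3⟩ := main r hr ε hε.ne'
  have : I ≤ ∑' n, ⨆ _ : (t n).Nonempty, ediam (t n) ^ m :=
    iInf_le_of_le t (iInf_le_of_le h1 (iInf_le _ h2))
  exact absurd (this.trans h3) (not_le.2 (by simpa [mul_comm] using hlt))

/-- Corollary zero: if `f : X → Y` is Lipschitz, `A ⊆ X` with
`ℋ^n(A) = 0` and `0 ≤ m ≤ n`, then `ℋ^{n−m}(f⁻¹(y) ∩ A) = 0` for `ℋ^m`-a.e. `y ∈ Y`. -/
theorem stmt17 {X Y : Type*} [MetricSpace X] [MeasurableSpace X] [BorelSpace X]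
    [MetricSpace Y] [MeasurableSpace Y] [BorelSpace Y]
    (f : X → Y) (hf : ∃ L : ℝ≥0, LipschitzWith L f)
    (A : Set X) (n m : ℝ) (hm : 0 ≤ m) (hmn : m ≤ n)
    (hA : μH[n] A = 0) :
    ∀ᵐ y ∂(μH[m] : Measure Y), μH[n - m] (f ⁻¹' {y} ∩ A) = 0 := by
  obtain ⟨L, hL⟩ := hf
  rcases hmn.eq_or_lt with rfl | hlt
  · have h0 : μH[m] (f '' A) = 0 := by
      have := hL.hausdorffMeasure_image_le hm A
      rw [hA, mul_zero] at this
      exact le_antisymm this (zero_le)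
    refine measure_mono_null (fun y hy => ?_) h0
    by_contra hyA
    apply hy
    have : f ⁻¹' {y} ∩ A = ∅ := by
      ext x
      simp only [mem_inter_iff, mem_preimage, mem_singleton_iff, mem_empty_iff_false, iff_false]
      rintro ⟨rfl, hx⟩
      exact hyA ⟨x, hx, rfl⟩
    simp [this]
  · let a : ℕ → ℝ≥0∞ := fun k => ((k : ℝ≥0∞) + 1)⁻¹
    let B : ℕ → Set Y := fun k => {y | ∀ t : ℕ → Set X, f ⁻¹' {y} ∩ A ⊆ ⋃ i, t i →
      (∀ i, ediam (t i) ≤ a k) → a k ≤ ∑' i, ⨆ _ : (t i).Nonempty, ediam (t i) ^ (n - m)}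
    have hB : ∀ k, μH[m] (B k) = 0 := fun k =>
      bad_null f L hL A n m hm hlt hA (a k) (by simp [a]) (by simp [a]) (B k) fun y hy => hy
    refine measure_mono_null (fun y hy => ?_) (measure_iUnion_null hB)
    have hy' : μH[n - m] (f ⁻¹' {y} ∩ A) ≠ 0 := hy
    rw [Measure.hausdorffMeasure_apply] at hy'
    simp only [ne_eq, ENNReal.iSup_eq_zero, not_forall] at hy'
    obtain ⟨r, hr, hne⟩ := hy'
    set I := ⨅ (t : ℕ → Set X) (_ : f ⁻¹' {y} ∩ A ⊆ ⋃ n, t n) (_ : ∀ n, ediam (t n) ≤ r),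
          ∑' i, ⨆ _ : (t i).Nonempty, ediam (t i) ^ (n - m) with hI
    obtain ⟨k, hk⟩ := ENNReal.exists_inv_nat_lt (a := min r I)
      (lt_min hr (pos_iff_ne_zero.2 hne)).ne'
    have hak : a k ≤ min r I :=
      (ENNReal.inv_le_inv.2 le_self_add).trans hk.le
    refine mem_iUnion.2 ⟨k, fun t ht htd => ?_⟩
    exact (hak.trans (min_le_right _ _)).trans (iInf_le_of_le t (iInf_le_of_le ht
      (iInf_le _ fun i => (htd i).trans (hak.trans (min_le_left _ _)))))

end
end
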